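/- There exists an absolute constant C > 0 such that the following holds. Let 0 < ε < 1/4 and let t, n be positive integers with n > ε^{-Ct}. Then every 2-colouring of the edges of the complete graph K_n with red and blue, in which every vertex has at least n/4 + εn neighbours in red and at least n/4 + εn neighbours in blue, contains 2t vertices on which one of the two colours induces exactly a complete bipartite graph K_{t,t} (i.e., an induced copy of K_{t,t} in some colour). -/

import Mathlib

open Finset

/-- A 2-colouring `c` (with `true` = red, `false` = blue) of a complete graph on `V`
contains an induced copy of `K_{t,t}` in colour `col`: there are `2t` vertices, split into
two disjoint sets `S`, `T` of size `t` each, such that all edges between `S` and `T` have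
colour `col` and all edges inside `S` and inside `T` have the other colour. -/
def HasInducedKtt {V : Type*} [DecidableEq V] (c : V → V → Bool) (t : ℕ) (col : Bool) : Prop :=
  ∃ S T : Finset V, Disjoint S T ∧ S.card = t ∧ T.card = t ∧
    (∀ u ∈ S, ∀ v ∈ T, c u v = col) ∧
    (∀ u ∈ S, ∀ v ∈ S, u ≠ v → c u v = !col) ∧
    (∀ u ∈ T, ∀ v ∈ T, u ≠ v → c u v = !col)

/-- `Y` contains a clique of size `t` in colour `col`. -/
def MonoIn {V : Type*} (c : V → V → Bool) (col : Bool) (t : ℕ) (Y : Finset V) : Prop :=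
  ∃ S ⊆ Y, S.card = t ∧ ∀ u ∈ S, ∀ v ∈ S, u ≠ v → c u v = col

lemma MonoIn.mono {V : Type*} {c : V → V → Bool} {col : Bool} {t : ℕ} {Y Z : Finset V}
    (h : MonoIn c col t Y) (hYZ : Y ⊆ Z) : MonoIn c col t Z := by
  obtain ⟨S, hS, h⟩ := h
  exact ⟨S, hS.trans hYZ, h⟩

lemma MonoIn.extend {V : Type*} [DecidableEq V] {c : V → V → Bool} (hc : ∀ u v, c u v = c v u)
    {col : Bool} {t : ℕ} {Y Z : Finset V} {x : V} (h : MonoIn c col t Z)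
    (hx : x ∈ Y) (hZ : ∀ z ∈ Z, z ∈ Y ∧ z ≠ x ∧ c x z = col) : MonoIn c col (t+1) Y := by
  obtain ⟨S, hS, hcard, h⟩ := h
  refine ⟨insert x S, ?_, ?_, ?_⟩
  · intro y hy
    rcases Finset.mem_insert.1 hy with rfl | hy
    · exact hx
    · exact (hZ y (hS hy)).1
  · rw [Finset.card_insert_of_notMem, hcard]
    intro hxS
    exact (hZ x (hS hxS)).2.1 rfl
  · intro u hu v hv huv
    rcases Finset.mem_insert.1 hu with rfl | hu' <;> rcases Finset.mem_insert.1 hv with rfl | hv'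
    · exact absurd rfl huv
    · exact (hZ v (hS hv')).2.2
    · rw [hc]; exact (hZ u (hS hu')).2.2
    · exact h u hu' v hv' huv

lemma ramsey_aux {V : Type*} [DecidableEq V] {c : V → V → Bool} (hc : ∀ u v, c u v = c v u)
    (m : ℕ) : ∀ s t : ℕ, s + t = m → ∀ Y : Finset V, 2 ^ m ≤ Y.card →
      MonoIn c true s Y ∨ MonoIn c false t Y := by
  induction m with
  | zero =>
    intro s t hst Y _
    left
    exact ⟨∅, by simp, by simp; omega, by simp⟩
  | succ m ih =>
    intro s t hst Y hY
    rcases s with _ | s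
    · left; exact ⟨∅, by simp, by simp, by simp⟩
    rcases t with _ | t
    · right; exact ⟨∅, by simp, by simp, by simp⟩
    have hpos : 0 < Y.card := lt_of_lt_of_le (by positivity) hY
    obtain ⟨x, hx⟩ := Finset.card_pos.1 hpos
    have h1 : ((Y.erase x).filter fun z => c x z = true).card
        + ((Y.erase x).filter fun z => ¬ c x z = true).card = Y.card - 1 := by
      rw [Finset.card_filter_add_card_filter_not, Finset.card_erase_of_mem hx]
    have h2 : 2 ^ m ≤ ((Y.erase x).filter fun z => c x z = true).card ∨
        2 ^ m ≤ ((Y.erase x).filter fun z => ¬ c x z = true).card := by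
      by_contra hcon
      rw [not_or, not_le, not_le] at hcon
      have : 2 ^ (m+1) = 2 * 2 ^ m := by ring
      omega
    rcases h2 with h2 | h2
    · rcases ih s (t+1) (by omega) _ h2 with h | h
      · left
        refine h.extend hc hx ?_
        intro z hz
        simp at hz
        tauto
      · right
        exact h.mono ((Finset.filter_subset _ _).trans (Finset.erase_subset _ _))
    · rcases ih (s+1) t (by omega) _ h2 with h | h
      · left
        exact h.mono ((Finset.filter_subset _ _).trans (Finset.erase_subset _ _))
      · right
        refine h.extend hc hx ?_
        intro z hz
        simp at hz
        tauto

lemma ramsey {V : Type*} [DecidableEq V] {c : V → V → Bool} (hc : ∀ u v, c u v = c v u)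
    (t : ℕ) (Y : Finset V) (hY : 4 ^ t ≤ Y.card) :
    MonoIn c true t Y ∨ MonoIn c false t Y := by
  apply ramsey_aux hc (t + t) t t rfl
  calc 2 ^ (t + t) = 4 ^ t := by rw [← two_mul, pow_mul]; norm_num
    _ ≤ _ := hY

lemma partition_lemma {V : Type*} [DecidableEq V] [Fintype V] {c : V → V → Bool}
    (hc : ∀ u v, c u v = c v u) (t a : ℕ) (hn : 0 < Fintype.card V)
    (ha : a * ((a + 1) * 4 ^ t) ≤ Fintype.card V) (ha0 : 0 < a) :
    ∃ B : Finset V,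
      (∀ Y ⊆ Bᶜ, Fintype.card V ≤ a * Y.card → MonoIn c true t Y) ∧
      (∀ Y ⊆ B, Fintype.card V ≤ a * Y.card → MonoIn c false t Y) := by
  classical
  set q := 4 ^ t with hq
  have hq0 : 0 < q := by positivity
  let P : Finset V → Prop := fun B => ∃ p, B.card = p * ((a+1) * q) ∧
    ∀ Y ⊆ B, ¬ MonoIn c false t Y → Y.card ≤ p * q
  obtain ⟨B, hB, hmax⟩ := Finset.exists_max_image (univ.filter P) Finset.card
    ⟨∅, by
      simp only [mem_filter, mem_univ, true_and]
      exact ⟨0, by simp, by intro Y hY _; simp [Finset.subset_empty.1 hY]⟩⟩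
  simp only [mem_filter, mem_univ, true_and] at hB hmax
  obtain ⟨p, hp, hpY⟩ := hB
  refine ⟨B, ?_, ?_⟩
  · intro Y hY hYc
    by_contra hno
    have hs : (a+1) * q ≤ Y.card := Nat.le_of_mul_le_mul_left (ha.trans hYc) ha0
    obtain ⟨X, hXY, hX⟩ := Finset.exists_subset_card_eq hs
    have hdis : Disjoint B X := by
      rw [Finset.disjoint_right]
      intro x hx
      exact Finset.mem_compl.1 (hY (hXY hx))
    have hcard : (B ∪ X).card = (p + 1) * ((a+1) * q) := by
      rw [Finset.card_union_of_disjoint hdis, hp, hX]; ring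
    have := hmax (B ∪ X) ⟨p+1, hcard, by
      intro Z hZ hZno
      have h1 : (Z \ X).card ≤ p * q := by
        apply hpY
        · intro z hz
          rw [Finset.mem_sdiff] at hz
          exact (Finset.mem_union.1 (hZ hz.1)).resolve_right hz.2
        · exact fun h => hZno (h.mono Finset.sdiff_subset)
      have h2 : (Z ∩ X).card < q := by
        by_contra! hge
        rcases ramsey hc t _ hge with h | h
        · exact hno (h.mono (Finset.inter_subset_right.trans hXY))
        · exact hZno (h.mono Finset.inter_subset_left)
      have h3 := Finset.card_sdiff_add_card_inter Z X
      nlinarith⟩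
    rw [hcard, hp] at this
    have : 0 < (a+1) * q := by positivity
    nlinarith
  · intro Y hY hYc
    by_contra hno
    have h1 := hpY Y hY hno
    have h2 : B.card ≤ Fintype.card V := Finset.card_le_univ B
    have h3 : a * Y.card ≤ a * (p * q) := Nat.mul_le_mul_left _ h1
    have h4 : 0 < p * q := by
      by_contra! h
      have : Y.card = 0 := by omega
      rw [this] at hYc
      omega
    rw [hp] at h2
    nlinarith

lemma drc {V : Type*} [DecidableEq V] [Fintype V] (A : V → V → Prop) [DecidableRel A]
    (a k t : ℕ) (δ : ℝ) (hδ : 0 < δ) (hn : 0 < Fintype.card V) (ha : 0 < a)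
    (hsum : δ * (Fintype.card V : ℝ) ^ 2 ≤ ∑ v, ((univ.filter fun u => A v u).card : ℝ))
    (hak : (Fintype.card V) ^ t * a ≤ a ^ k) (hδa : 2 < a * δ ^ k) (hk : 0 < k) :
    ∃ w : Fin k → V, Fintype.card V ≤ a * (univ.filter fun v => ∀ i, A v (w i)).card ∧
      ∀ S ⊆ (univ.filter fun v => ∀ i, A v (w i)), S.card = t →
        Fintype.card V ≤ a * (univ.filter fun u => ∀ v ∈ S, A v u).card := by
  classical
  by_contra! hcon
  set n := Fintype.card V with hndef
  set U : (Fin k → V) → Finset V := fun w => univ.filter fun v => ∀ i, A v (w i) with hU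
  set N : Finset V → Finset V := fun S => univ.filter fun u => ∀ v ∈ S, A v u with hN
  set F : Finset (Finset V) := (univ.powersetCard t).filter fun S => a * (N S).card < n with hF
  have hn' : (0:ℝ) < n := by exact_mod_cast hn
  have ha' : (0:ℝ) < a := by exact_mod_cast ha
  have hpt : ∀ w, ((U w).card : ℝ) ≤ n / a + ∑ S ∈ F, (if S ⊆ U w then (n:ℝ) else 0) := by
    intro w
    have hnn : 0 ≤ ∑ S ∈ F, (if S ⊆ U w then (n:ℝ) else 0) :=
      Finset.sum_nonneg fun S _ => by split_ifs <;> positivity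
    by_cases h : n ≤ a * (U w).card
    · obtain ⟨S, hSU, hSt, hSN⟩ := hcon w h
      have hSF : S ∈ F := by
        rw [hF, mem_filter, mem_powersetCard]
        exact ⟨⟨subset_univ _, hSt⟩, hSN⟩
      have h1 := Finset.single_le_sum (f := fun S => if S ⊆ U w then (n:ℝ) else 0)
        (fun S _ => by split_ifs <;> positivity) hSF
      have hSU' : S ⊆ U w := hSU
      simp only [hSU', if_true] at h1
      have h2 : ((U w).card : ℝ) ≤ n := by exact_mod_cast Finset.card_le_univ _
      have h3 : (0:ℝ) ≤ n / a := by positivity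
      linarith
    · push Not at h
      have h1 : (a:ℝ) * (U w).card < n := by exact_mod_cast h
      have h2 : ((U w).card : ℝ) ≤ n / a := by
        rw [le_div_iff₀ ha']; linarith
      linarith
  have hcount : ∀ S, ∑ w : Fin k → V, (if S ⊆ U w then (n:ℝ) else 0) = n * ((N S).card : ℝ) ^ k := by
    intro S
    rw [← Finset.sum_filter, Finset.sum_const, nsmul_eq_mul, mul_comm]
    congr 1
    have : (univ.filter fun w => S ⊆ U w) = Fintype.piFinset (fun _ : Fin k => N S) := by
      ext w
      simp only [hU, hN, mem_filter, mem_univ, true_and, Fintype.mem_piFinset, Finset.subset_iff]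
      tauto
    rw [this, Fintype.card_piFinset_const]
    push_cast; rfl
  have hlow : ∑ w, ((U w).card : ℝ) = ∑ v, ((univ.filter fun u => A v u).card : ℝ) ^ k := by
    have h1 : ∀ w, ((U w).card : ℝ) = ∑ v, if (∀ i, A v (w i)) then (1:ℝ) else 0 := by
      intro w
      simp [hU]
    simp_rw [h1]
    rw [Finset.sum_comm]
    refine Finset.sum_congr rfl fun v _ => ?_
    have : (univ.filter fun w : Fin k → V => ∀ i, A v (w i)) =
        Fintype.piFinset (fun _ : Fin k => univ.filter fun u => A v u) := by
      ext w
      simp [Fintype.mem_piFinset]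
    rw [Finset.sum_boole, this, Fintype.card_piFinset_const]
    push_cast; rfl
  have hpow : (n:ℝ) * (δ * n) ^ k ≤ ∑ v, ((univ.filter fun u => A v u).card : ℝ) ^ k := by
    obtain ⟨j, rfl⟩ : ∃ j, k = j + 1 := ⟨k - 1, by omega⟩
    refine le_trans ?_ (pow_sum_div_card_le_sum_pow (s := (univ : Finset V)) (f := fun v => ((univ.filter fun u => A v u).card : ℝ)) (fun _ _ => by positivity) j)
    rw [Finset.card_univ, ← hndef, le_div_iff₀ (by positivity)]
    calc (n:ℝ) * (δ * n) ^ (j+1) * n ^ j = (δ * (n:ℝ)^2) ^ (j+1) := by ring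
      _ ≤ _ := by gcongr
  have hup : ∑ w, ((U w).card : ℝ) ≤ (n:ℝ)^k * (n / a) + n * ((n:ℝ)^t * (n/a)^k) := by
    calc ∑ w, ((U w).card : ℝ) ≤ ∑ w : Fin k → V, (n / a + ∑ S ∈ F, (if S ⊆ U w then (n:ℝ) else 0)) :=
          Finset.sum_le_sum fun w _ => hpt w
      _ = (n:ℝ)^k * (n / a) + ∑ S ∈ F, n * ((N S).card : ℝ) ^ k := by
          rw [Finset.sum_add_distrib, Finset.sum_comm]
          simp_rw [hcount]
          simp [hndef]
      _ ≤ (n:ℝ)^k * (n / a) + ∑ S ∈ F, n * ((n:ℝ)/a) ^ k := by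
          gcongr with S hS
          rw [hF, mem_filter] at hS
          rw [le_div_iff₀ ha']
          have : (a:ℝ) * (N S).card < n := by exact_mod_cast hS.2
          linarith
      _ ≤ _ := by
          rw [Finset.sum_const, nsmul_eq_mul]
          have : F.card ≤ n ^ t := by
            refine (Finset.card_filter_le _ _).trans ?_
            rw [Finset.card_powersetCard, Finset.card_univ]
            exact Nat.choose_le_pow _ _
          have h' : (F.card : ℝ) ≤ (n:ℝ)^t := by exact_mod_cast this
          have : (F.card:ℝ) * (n * ((n:ℝ)/a)^k) ≤ (n:ℝ)^t * (n * ((n:ℝ)/a)^k) := by gcongr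
          linarith
  have hak' : (n:ℝ)^t * a ≤ (a:ℝ)^k := by exact_mod_cast hak
  have h5 : (n:ℝ)^t * (n/a)^k ≤ (n:ℝ)^k / a := by
    rw [div_pow, mul_div_assoc', div_le_div_iff₀ (by positivity) ha']
    have : (0:ℝ) < (n:ℝ)^k := by positivity
    nlinarith
  have h6 : (n:ℝ) * (δ * n) ^ k ≤ 2 * n * n^k / a := by
    have : (n:ℝ) * ((n:ℝ)^t * (n/a)^k) ≤ n * ((n:ℝ)^k / a) := by gcongr
    calc _ ≤ _ := hpow
      _ ≤ _ := hlow ▸ hup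
      _ ≤ (n:ℝ)^k * (n / a) + n * ((n:ℝ)^k / a) := by linarith
      _ = _ := by ring
  rw [le_div_iff₀ ha', mul_pow] at h6
  have h7 : (0:ℝ) < n * n^k := by positivity
  nlinarith

lemma find_ktt {V : Type*} [DecidableEq V] [Fintype V] {c : V → V → Bool}
    (R : Finset V) (col : Bool)
    (a k t : ℕ) (δ : ℝ) (hδ : 0 < δ) (hn : 0 < Fintype.card V) (ha : 0 < a)
    (hsum : δ * (Fintype.card V : ℝ) ^ 2 ≤
      ∑ v ∈ R, ((R.filter fun u => u ≠ v ∧ c v u = !col).card : ℝ))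
    (hak : (Fintype.card V) ^ t * a ≤ a ^ k) (hδa : 2 < a * δ ^ k) (hk : 0 < k) (ht : 0 < t)
    (hR : ∀ Y ⊆ R, Fintype.card V ≤ a * Y.card → MonoIn c col t Y) :
    HasInducedKtt c t (!col) := by
  classical
  obtain ⟨w, hw1, hw2⟩ := drc (fun v u => v ∈ R ∧ u ∈ R ∧ u ≠ v ∧ c v u = !col) a k t δ hδ hn ha
    (by
      refine hsum.trans ?_
      calc _ ≤ ∑ v ∈ R, ((univ.filter fun u => v ∈ R ∧ u ∈ R ∧ u ≠ v ∧ c v u = !col).card : ℝ) := by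
            refine Finset.sum_le_sum fun v hv => ?_
            norm_cast
            apply Finset.card_le_card
            intro u hu
            simp only [mem_filter, mem_univ, true_and] at hu ⊢
            tauto
        _ ≤ _ := Finset.sum_le_sum_of_subset_of_nonneg (subset_univ _) (fun _ _ _ => by positivity))
    hak hδa hk
  obtain ⟨S, hSU, hSc, hS⟩ := hR _ (by
    intro v hv
    simp only [mem_filter, mem_univ, true_and] at hv
    exact (hv ⟨0, hk⟩).1) hw1
  have hSne : S.Nonempty := by rw [← Finset.card_pos]; omega
  obtain ⟨x, hx⟩ := hSne
  obtain ⟨T, hTN, hTc, hT⟩ := hR _ (by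
    intro v hv
    simp only [mem_filter, mem_univ, true_and] at hv
    exact (hv x hx).2.1) (hw2 S hSU hSc)
  have hST : ∀ u ∈ S, ∀ v ∈ T, v ≠ u ∧ c u v = !col := by
    intro u hu v hv
    have := hTN hv
    simp only [mem_filter, mem_univ, true_and] at this
    exact (this u hu).2.2
  refine ⟨S, T, ?_, hSc, hTc, fun u hu v hv => (hST u hu v hv).2, ?_, ?_⟩
  · rw [Finset.disjoint_left]
    intro u hu hv
    exact (hST u hu u hv).1 rfl
  · simpa using hS
  · simpa using hT

lemma numeric (ε : ℝ) (t n : ℕ) (h0 : 0 < ε) (h1 : ε < 1/4) (ht : 0 < t)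
    (hn : (n : ℝ) > ε ^ (-((200:ℝ) * t))) :
    ∃ a : ℕ, 0 < a ∧ a * ((a + 1) * 4 ^ t) ≤ n ∧ n ^ t * a ≤ a ^ (16 * t) ∧
      2 < a * (ε / 2) ^ (16 * t) := by
  set y : ℝ := ε⁻¹ with hy
  have hy4 : 4 < y := by
    rw [hy, lt_inv_comm₀ (by norm_num) h0]; linarith
  have hn' : y ^ (200 * t) < n := by
    have : ε ^ (-((200:ℝ) * t)) = y ^ (200 * t) := by
      rw [Real.rpow_neg h0.le, hy, inv_pow, ← Real.rpow_natCast]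
      push_cast; rfl
    rw [← this]; exact hn
  obtain ⟨a, ha1, ha2⟩ : ∃ a : ℕ, a ^ 4 ≤ n ∧ n < (a + 1) ^ 4 := by
    refine ⟨Nat.sqrt (Nat.sqrt n), ?_, ?_⟩
    · have h1 := Nat.sqrt_le' n
      have h2 := Nat.sqrt_le' (Nat.sqrt n)
      calc _ = (Nat.sqrt (Nat.sqrt n) ^ 2) ^ 2 := by ring
        _ ≤ (Nat.sqrt n) ^ 2 := by gcongr
        _ ≤ n := h1
    · have h1 := Nat.lt_succ_sqrt' n
      have h2 := Nat.lt_succ_sqrt' (Nat.sqrt n)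
      calc n < (Nat.sqrt n + 1) ^ 2 := h1
        _ ≤ ((Nat.sqrt (Nat.sqrt n) + 1) ^ 2) ^ 2 := by gcongr; exact h2
        _ = _ := by ring
  have hy1 : (1:ℝ) ≤ y := by linarith
  set z : ℝ := y ^ (32 * t) with hz
  have h3 : y ^ (50 * t) < a + 1 := by
    have : (y ^ (50 * t)) ^ 4 < ((a:ℝ) + 1) ^ 4 := by
      calc (y ^ (50 * t)) ^ 4 = y ^ (200 * t) := by rw [← pow_mul]; ring_nf
        _ < n := hn'
        _ < _ := by exact_mod_cast ha2
    exact lt_of_pow_lt_pow_left₀ 4 (by positivity) this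
  have hz1 : 1 ≤ z := one_le_pow₀ hy1
  have h4 : 4 * z ≤ y ^ (50 * t) := by
    have : y ^ (50 * t) = y ^ (18 * t) * z := by rw [hz, ← pow_add]; ring_nf
    rw [this]
    gcongr
    calc (4:ℝ) ≤ y ^ 1 := by linarith
      _ ≤ y ^ (18 * t) := pow_le_pow_right₀ hy1 (by omega)
  have haz : 2 * z < a := by linarith
  have ha0 : 2 ≤ a := by
    have : (2:ℝ) < a := by linarith
    have : 2 < a := by exact_mod_cast this
    omega
  have ha4 : 4 ^ t ≤ a := by
    have : (4:ℝ) ^ t ≤ z := by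
      calc (4:ℝ)^t ≤ y ^ t := by gcongr
        _ ≤ z := pow_le_pow_right₀ hy1 (by omega)
    have : (4:ℝ)^t ≤ a := by linarith
    exact_mod_cast this
  refine ⟨a, by omega, ?_, ?_, ?_⟩
  · calc a * ((a+1) * 4^t) ≤ a * (a^2 * a) := by
          gcongr; nlinarith
      _ = a^4 := by ring
      _ ≤ n := ha1
  · have hna : n ≤ a ^ 8 := by
      calc n ≤ (a+1)^4 := ha2.le
        _ ≤ (a^2)^4 := by gcongr; nlinarith
        _ = a^8 := by ring
    calc n ^ t * a ≤ (a^8)^t * a ^ (8 * t) := by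
          gcongr
          calc a = a ^ 1 := (pow_one a).symm
            _ ≤ a ^ (8 * t) := Nat.pow_le_pow_right (by omega) (by omega)
      _ = a ^ (16 * t) := by rw [← pow_mul, ← pow_add]; ring_nf
  · have h5 : 1 ≤ z * (ε/2)^(16*t) := by
      have : z * (ε/2)^(16*t) = (y^2 * (ε/2))^(16*t) := by
        rw [mul_pow, hz, ← pow_mul]; ring_nf
      rw [this]
      apply one_le_pow₀
      have : y * ε = 1 := inv_mul_cancel₀ h0.ne'
      nlinarith
    have : 0 < (ε/2)^(16*t) := by positivity
    nlinarith

/-- There is an absolute constant `C > 0` such that for every `0 < ε < 1/4` and positive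
integers `t, n` with `n > ε^{-Ct}`, every 2-colouring of `K_n` in which every vertex has at
least `n/4 + εn` neighbours in each colour contains an induced copy of `K_{t,t}` in some
colour. -/
theorem stmt_0 :
    ∃ C : ℝ, 0 < C ∧
      ∀ (ε : ℝ) (t n : ℕ), 0 < ε → ε < 1 / 4 → 0 < t → 0 < n →
        (n : ℝ) > ε ^ (-(C * t)) →
        ∀ c : Fin n → Fin n → Bool, (∀ u v, c u v = c v u) →
          (∀ v : Fin n, ∀ col : Bool,
            (((univ.filter fun u => u ≠ v ∧ c v u = col)).card : ℝ) ≥ n / 4 + ε * n) →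
          ∃ col, HasInducedKtt c t col := by
  refine ⟨200, by norm_num, ?_⟩
  intro ε t n h0 h1 ht hn0 hn c hc hdeg
  obtain ⟨a, ha0, ha1, ha2, ha3⟩ := numeric ε t n h0 h1 ht hn
  obtain ⟨B, hBr, hBb⟩ := partition_lemma hc t a (by simpa using hn0) (by simpa using ha1) ha0
  -- degree count
  have hsplit : ∀ (X : Finset (Fin n)) (v : Fin n) (col : Bool),
      ((univ.filter fun u => u ≠ v ∧ c v u = col).card : ℝ) =
      ((X.filter fun u => u ≠ v ∧ c v u = col).card : ℝ) +
      ((Xᶜ.filter fun u => u ≠ v ∧ c v u = col).card : ℝ) := by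
    intro X v col
    rw [← Nat.cast_add, ← Finset.card_union_of_disjoint, ← Finset.filter_union,
      Finset.union_compl]
    exact Finset.disjoint_filter_filter disjoint_compl_right
  have hR : ∑ v ∈ Bᶜ, ((n:ℝ)/4 + ε * n) ≤
      ∑ v ∈ Bᶜ, ((Bᶜ.filter fun u => u ≠ v ∧ c v u = !true).card : ℝ) +
      ∑ v ∈ Bᶜ, ((B.filter fun u => c v u = false).card : ℝ) := by
    rw [← Finset.sum_add_distrib]
    refine Finset.sum_le_sum fun v _ => ?_
    refine (hdeg v false).trans ?_
    rw [hsplit Bᶜ v false, compl_compl]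
    gcongr
    · simp
    · intro h; exact h.2
  have hB : ∑ v ∈ B, ((n:ℝ)/4 + ε * n) ≤
      ∑ v ∈ B, ((B.filter fun u => u ≠ v ∧ c v u = !false).card : ℝ) +
      ∑ v ∈ B, ((Bᶜ.filter fun u => c v u = true).card : ℝ) := by
    rw [← Finset.sum_add_distrib]
    refine Finset.sum_le_sum fun v _ => ?_
    refine (hdeg v true).trans ?_
    rw [hsplit B v true]
    gcongr
    · simp
    · intro h; exact h.2
  have hcross : ∑ v ∈ Bᶜ, ((B.filter fun u => c v u = false).card : ℝ) +
      ∑ v ∈ B, ((Bᶜ.filter fun u => c v u = true).card : ℝ) = (B.card : ℝ) * (Bᶜ.card : ℝ) := by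
    have e1 : ∑ v ∈ Bᶜ, ((B.filter fun u => c v u = false).card : ℝ) =
        ∑ v ∈ B, ((Bᶜ.filter fun u => ¬ c v u = true).card : ℝ) := by
      simp only [← Finset.sum_boole]
      rw [Finset.sum_comm]
      refine Finset.sum_congr rfl fun v _ => Finset.sum_congr rfl fun u _ => ?_
      rw [hc u v]; simp
    rw [e1, ← Finset.sum_add_distrib, ← nsmul_eq_mul, ← Finset.sum_const]
    refine Finset.sum_congr rfl fun v _ => ?_
    rw [← Nat.cast_add, add_comm, Finset.card_filter_add_card_filter_not]
  have hcard : (B.card : ℝ) + (Bᶜ.card : ℝ) = n := by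
    rw [← Nat.cast_add, Finset.card_add_card_compl, Fintype.card_fin]
  rw [Finset.sum_const, nsmul_eq_mul] at hR hB
  have hkey : ε * (n:ℝ)^2 ≤
      ∑ v ∈ Bᶜ, ((Bᶜ.filter fun u => u ≠ v ∧ c v u = !true).card : ℝ) +
      ∑ v ∈ B, ((B.filter fun u => u ≠ v ∧ c v u = !false).card : ℝ) := by
    rw [← hcard] at hR hB ⊢
    nlinarith [sq_nonneg ((B.card : ℝ) - (Bᶜ.card : ℝ))]
  rcases le_total (ε / 2 * (n:ℝ)^2)
    (∑ v ∈ Bᶜ, ((Bᶜ.filter fun u => u ≠ v ∧ c v u = !true).card : ℝ)) with h | h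
  · exact ⟨_, find_ktt Bᶜ true a (16 * t) t (ε/2) (by positivity) (by simpa using hn0) ha0
      (by simpa using h) (by simpa using ha2) ha3 (by omega) ht hBr⟩
  · have h' : ε / 2 * (n:ℝ)^2 ≤
      ∑ v ∈ B, ((B.filter fun u => u ≠ v ∧ c v u = !false).card : ℝ) := by linarith
    exact ⟨_, find_ktt B false a (16 * t) t (ε/2) (by positivity) (by simpa using hn0) ha0
      (by simpa using h') (by simpa using ha2) ha3 (by omega) ht hBb⟩
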